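/- Suppose the rate coefficients satisfy the growth condition (GB) and, in addition, there exist α ∈ [0, 1/2) and a constant C > 0 such that a(i,j;k) ≤ C (i−k+1)^α (j^α + k^α) q_{i,k} for all integers 1 ≤ k ≤ i and all j ≥ 0, where the q_{i,k} satisfy ∑_{k=1}^{i} k(i−k+1) q_{i,k} ≤ Q·i for all i ≥ 1. Let T ∈ (0,∞) and c_0 ∈ X_{0,1}^+. Then the initial value problem for the isolated DGED system with initial datum c_0 has at most one mild solution on [0,T]: any two mild solutions with initial datum c_0 coincide on [0,T]. -/

import Mathlib

open Finset MeasureTheory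

/-- Infinite-system operator `Q_{1,i}`. -/
noncomputable def Qi1 (a : ℕ → ℕ → ℕ → ℝ) (c : ℕ → ℝ) (i : ℕ) : ℝ :=
  ∑' p : ℕ × ℕ, if 1 ≤ p.1 then a (i + p.1) p.2 p.1 * c (i + p.1) * c p.2 else 0

/-- Infinite-system operator `Q_{2,i}`. -/
noncomputable def Qi2 (a : ℕ → ℕ → ℕ → ℝ) (c : ℕ → ℝ) (i : ℕ) : ℝ :=
  -∑' p : ℕ × ℕ, if 1 ≤ p.1 ∧ p.1 ≤ p.2 then a p.2 i p.1 * c p.2 * c i else 0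

/-- Infinite-system operator `Q_{3,i}` (equal to `0` when `i = 0`). -/
noncomputable def Qi3 (a : ℕ → ℕ → ℕ → ℝ) (c : ℕ → ℝ) (i : ℕ) : ℝ :=
  ∑ k ∈ Finset.Icc 1 i, ∑' j : ℕ, if k ≤ j then a j (i - k) k * c j * c (i - k) else 0

/-- Infinite-system operator `Q_{4,i}` (equal to `0` when `i = 0`). -/
noncomputable def Qi4 (a : ℕ → ℕ → ℕ → ℝ) (c : ℕ → ℝ) (i : ℕ) : ℝ :=
  -∑ k ∈ Finset.Icc 1 i, ∑' j : ℕ, a i j k * c j * c i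

/-- Summability of all the series defining the operators `Q_{j,i}`. -/
def QSummable (a : ℕ → ℕ → ℕ → ℝ) (c : ℕ → ℝ) (i : ℕ) : Prop :=
  Summable (fun p : ℕ × ℕ =>
    if 1 ≤ p.1 then a (i + p.1) p.2 p.1 * c (i + p.1) * c p.2 else 0) ∧
  Summable (fun p : ℕ × ℕ =>
    if 1 ≤ p.1 ∧ p.1 ≤ p.2 then a p.2 i p.1 * c p.2 * c i else 0) ∧
  (∀ k ∈ Finset.Icc 1 i,
    Summable (fun j : ℕ => if k ≤ j then a j (i - k) k * c j * c (i - k) else 0)) ∧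
  (∀ k ∈ Finset.Icc 1 i, Summable (fun j : ℕ => a i j k * c j * c i))

/-- `c` is a mild solution of the isolated DGED system on the set `S` with
initial datum `c0 ∈ X_{0,1}^+`. -/
def MildSolIso (a : ℕ → ℕ → ℕ → ℝ) (c0 : ℕ → ℝ) (S : Set ℝ) (c : ℕ → ℝ → ℝ) : Prop :=
  (∀ i, c i 0 = c0 i) ∧
  (∀ t ∈ S, (∀ i, 0 ≤ c i t) ∧ Summable (fun i : ℕ => (1 + (i : ℝ)) * c i t)) ∧
  (∀ i, ContinuousOn (c i) S) ∧
  (∀ i : ℕ, ∀ t ∈ S,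
    (∀ᵐ s ∂(volume.restrict (Set.Ioc 0 t)), QSummable a (fun n => c n s) i) ∧
    IntegrableOn (fun s => Qi1 a (fun n => c n s) i) (Set.Ioc 0 t) ∧
    IntegrableOn (fun s => Qi2 a (fun n => c n s) i) (Set.Ioc 0 t) ∧
    IntegrableOn (fun s => Qi3 a (fun n => c n s) i) (Set.Ioc 0 t) ∧
    IntegrableOn (fun s => Qi4 a (fun n => c n s) i) (Set.Ioc 0 t) ∧
    c i t = c0 i + ∫ s in (0 : ℝ)..t,
      (Qi1 a (fun n => c n s) i + Qi2 a (fun n => c n s) i +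
        Qi3 a (fun n => c n s) i + Qi4 a (fun n => c n s) i))

/-- `c` is a mild solution of the non-isolated DGED system on the set `S` with
initial datum `c0 ∈ X_{0,1}^+`: the concentration of `0`-clusters is constant and the
components `c_i`, `i ≥ 1`, satisfy the integral equations. -/
def MildSolNon (a : ℕ → ℕ → ℕ → ℝ) (c0 : ℕ → ℝ) (S : Set ℝ) (c : ℕ → ℝ → ℝ) : Prop :=
  (∀ i, c i 0 = c0 i) ∧
  (∀ t ∈ S, (∀ i, 0 ≤ c i t) ∧ Summable (fun i : ℕ => (1 + (i : ℝ)) * c i t)) ∧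
  (∀ i, ContinuousOn (c i) S) ∧
  (∀ t ∈ S, c 0 t = c0 0) ∧
  (∀ i : ℕ, 1 ≤ i → ∀ t ∈ S,
    (∀ᵐ s ∂(volume.restrict (Set.Ioc 0 t)), QSummable a (fun n => c n s) i) ∧
    IntegrableOn (fun s => Qi1 a (fun n => c n s) i) (Set.Ioc 0 t) ∧
    IntegrableOn (fun s => Qi2 a (fun n => c n s) i) (Set.Ioc 0 t) ∧
    IntegrableOn (fun s => Qi3 a (fun n => c n s) i) (Set.Ioc 0 t) ∧
    IntegrableOn (fun s => Qi4 a (fun n => c n s) i) (Set.Ioc 0 t) ∧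
    c i t = c0 i + ∫ s in (0 : ℝ)..t,
      (Qi1 a (fun n => c n s) i + Qi2 a (fun n => c n s) i +
        Qi3 a (fun n => c n s) i + Qi4 a (fun n => c n s) i))

/-- Growth condition (GB) on the rate coefficients. -/
def GB (a : ℕ → ℕ → ℕ → ℝ) (C Q : ℝ) (q : ℕ → ℕ → ℝ) : Prop :=
  1 ≤ C ∧ 1 ≤ Q ∧ (∀ i k, 0 ≤ q i k) ∧
  (∀ i : ℕ, 1 ≤ i →
    ∑ k ∈ Finset.Icc 1 i, (k : ℝ) * ((i : ℝ) - k + 1) * q i k ≤ Q * i) ∧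
  (∀ i j k : ℕ, 1 ≤ k → k ≤ i → 1 ≤ j →
    a i j k ≤ C * ((i : ℝ) - k + 1) * ((j : ℝ) + k) * q i k)

section

/-- Integral formula for the absolute value of a primitive. -/
theorem abs_primitive (g : ℝ → ℝ) (t : ℝ)
    (hg : IntervalIntegrable g volume 0 t) :
    |∫ x in (0:ℝ)..t, g x| = ∫ s in (0:ℝ)..t, Real.sign (∫ x in (0:ℝ)..s, g x) * g s := by
  set W : ℝ → ℝ := fun s => ∫ x in (0:ℝ)..s, g x with hW
  have hac : AbsolutelyContinuousOnInterval W 0 t :=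
    hg.absolutelyContinuousOnInterval_intervalIntegral (by simp)
  have hac2 : AbsolutelyContinuousOnInterval (fun s => |W s|) 0 t := by
    unfold AbsolutelyContinuousOnInterval at hac ⊢
    refine squeeze_zero (fun E => Finset.sum_nonneg fun _ _ => dist_nonneg)
      (fun E => Finset.sum_le_sum fun i _ => ?_) hac
    rw [Real.dist_eq, Real.dist_eq]
    exact abs_abs_sub_abs_le_abs_sub _ _
  have h0 : |W 0| = 0 := by simp [hW]
  have h1 := hac2.integral_deriv_eq_sub
  rw [h0, sub_zero] at h1
  rw [show |∫ x in (0:ℝ)..t, g x| = |W t| from rfl, ← h1]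
  apply intervalIntegral.integral_congr_ae
  filter_upwards [hac2.ae_differentiableAt, hg.ae_hasDerivAt_integral] with x hx1 hx2 hx3
  have hx4 : x ∈ Set.uIcc 0 t := Set.uIoc_subset_uIcc hx3
  have hd : HasDerivAt W (g x) x := hx2 hx4 0 (by simp)
  rcases lt_trichotomy (W x) 0 with h | h | h
  · rw [Real.sign_of_neg h]
    have : HasDerivAt (fun s => |W s|) (-1 * g x) x := (hasDerivAt_abs_neg h).comp x hd
    exact this.deriv
  · rw [show (∫ (x : ℝ) in (0:ℝ)..x, g x) = 0 from h, Real.sign_zero, zero_mul]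
    apply IsLocalMin.deriv_eq_zero
    filter_upwards with y
    simp [h]
  · rw [Real.sign_of_pos h]
    have : HasDerivAt (fun s => |W s|) (1 * g x) x := (hasDerivAt_abs_pos h).comp x hd
    exact this.deriv

/-- A lower semicontinuous function which is conserved on the intervals where it is bounded
is constant (Baire category argument). -/
theorem baire_const (M : ℝ → ℝ) (hcl : ∀ n : ℕ, IsClosed {t | M t ≤ n})
    (hcons : ∀ s t B, s ≤ t → (∀ x ∈ Set.Icc s t, M x ≤ B) → M s = M t) (s t : ℝ) (hst : s ≤ t) :
    M s = M t := by
  set F : Set ℝ := {x | ¬ ∃ B, ∀ᶠ y in nhds x, M y ≤ B} with hF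
  have hFo : IsOpen Fᶜ := by
    rw [isOpen_iff_mem_nhds]
    intro x hx
    simp only [hF, Set.mem_compl_iff, Set.mem_ofPred_eq, not_not] at hx
    obtain ⟨B, hB⟩ := hx
    filter_upwards [eventually_eventually_nhds.2 hB] with y hy
    simp only [hF, Set.mem_compl_iff, Set.mem_ofPred_eq, not_not]
    exact ⟨B, hy⟩
  have hFc : IsClosed F := isOpen_compl_iff.1 hFo
  have hloc : ∀ u v, u ≤ v → (∀ x ∈ Set.Icc u v, x ∉ F) → M u = M v := by
    intro u v huv h
    have : ∃ B, ∀ x ∈ Set.Icc u v, M x ≤ B := by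
      refine (isCompact_Icc (a := u) (b := v)).induction_on
        (p := fun S => ∃ B, ∀ x ∈ S, M x ≤ B) ⟨0, by simp⟩ ?_ ?_ ?_
      · rintro S S' hS ⟨B, hB⟩
        exact ⟨B, fun x hx => hB x (hS hx)⟩
      · rintro S S' ⟨B, hB⟩ ⟨B', hB'⟩
        refine ⟨max B B', ?_⟩
        rintro x (hx | hx)
        · exact (hB x hx).trans (le_max_left _ _)
        · exact (hB' x hx).trans (le_max_right _ _)
      · intro x hx
        have h2 := h x hx
        simp only [hF, Set.mem_ofPred_eq, not_not] at h2
        obtain ⟨B, hB⟩ := h2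
        exact ⟨_, mem_nhdsWithin_of_mem_nhds hB, B, fun y hy => hy⟩
    obtain ⟨B, hB⟩ := this
    exact hcons u v B huv hB
  rcases F.eq_empty_or_nonempty with hE | hne
  · exact hloc s t hst (by simp [hE])
  exfalso
  have : Nonempty F := hne.to_subtype
  have : CompleteSpace F := hFc.isComplete.completeSpace_coe
  obtain ⟨n, x, hx⟩ := nonempty_interior_of_iUnion_of_closed
    (f := fun n : ℕ => {x : F | M x ≤ n})
    (fun n => (hcl n).preimage continuous_subtype_val)
    (by
      ext x
      simp only [Set.mem_iUnion, Set.mem_ofPred_eq, Set.mem_univ, iff_true]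
      exact exists_nat_ge _)
  rw [mem_interior_iff_mem_nhds, Metric.mem_nhds_iff] at hx
  obtain ⟨ε, hε, hb⟩ := hx
  have hb' : ∀ y ∈ F, |y - x| < ε → M y ≤ n := by
    intro y hy hyx
    have : (⟨y, hy⟩ : F) ∈ Metric.ball x ε := by
      rw [Metric.mem_ball, Subtype.dist_eq, Real.dist_eq]; exact hyx
    exact hb this
  have hxF := x.2
  refine x.2 ⟨n, ?_⟩
  filter_upwards [Metric.ball_mem_nhds (x : ℝ) hε] with y hy
  rw [Metric.mem_ball, Real.dist_eq] at hy
  by_cases hyF : y ∈ F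
  · exact hb' y hyF hy
  rcases le_total (x : ℝ) y with hxy | hxy
  · have hK : IsCompact (F ∩ Set.Icc (x : ℝ) y) := isCompact_Icc.inter_left hFc
    obtain ⟨b, hb1, hb2⟩ := hK.exists_isGreatest ⟨x, hxF, le_rfl, hxy⟩
    have hby : b < y := lt_of_le_of_ne hb1.2.2 (by rintro rfl; exact hyF hb1.1)
    have hz : ∀ z ∈ Set.Ioc b y, M z = M y := by
      intro z hz
      refine hloc z y hz.2 fun w hw hwF => ?_
      have := hb2 ⟨hwF, hb1.2.1.trans (hz.1.le.trans hw.1), hw.2⟩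
      linarith [hz.1, hw.1]
    have h3 : M b = M y := by
      refine hcons b y (max (M b) (M y)) hby.le fun z hz' => ?_
      rcases eq_or_lt_of_le hz'.1 with h | h
      · rw [← h]; exact le_max_left _ _
      · rw [hz z ⟨h, hz'.2⟩]; exact le_max_right _ _
    rw [← h3]
    refine hb' b hb1.1 ?_
    rw [abs_of_nonneg (by linarith [hb1.2.1])]
    rw [abs_of_nonneg (by linarith)] at hy
    linarith
  · have hK : IsCompact (F ∩ Set.Icc y (x : ℝ)) := isCompact_Icc.inter_left hFc
    obtain ⟨b, hb1, hb2⟩ := hK.exists_isLeast ⟨x, hxF, hxy, le_rfl⟩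
    have hby : y < b := lt_of_le_of_ne hb1.2.1 (by rintro rfl; exact hyF hb1.1)
    have hz : ∀ z ∈ Set.Ico y b, M y = M z := by
      intro z hz
      refine hloc y z hz.1 fun w hw hwF => ?_
      have := hb2 ⟨hwF, hw.1, hw.2.trans (hz.2.le.trans hb1.2.2)⟩
      linarith [hz.2, hw.2]
    have h3 : M y = M b := by
      refine hcons y b (max (M b) (M y)) hby.le fun z hz' => ?_
      rcases eq_or_lt_of_le hz'.2 with h | h
      · rw [h]; exact le_max_left _ _
      · rw [← hz z ⟨hz'.1, h⟩]; exact le_max_right _ _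
    rw [h3]
    refine hb' b hb1.1 ?_
    rw [abs_of_nonpos (by linarith [hb1.2.2])]
    rw [abs_of_nonpos (by linarith)] at hy
    linarith

end

section

theorem r1 (x k j : ℝ) (hx : 1 ≤ x) (hk : 1 ≤ k) (hj : 0 ≤ j) :
    √x * (√j + √k) ≤ 2 * √(1+j) * √(x+k) * √(min x k) := by
  have h1 : √j + √k ≤ 2 * (√(1+j) * √k) := by
    have e1 : √j ≤ √(1+j) * √k := by
      rw [← Real.sqrt_mul (by linarith)]
      exact Real.sqrt_le_sqrt (by nlinarith)
    have e2 : √k ≤ √(1+j) * √k := by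
      rw [← Real.sqrt_mul (by linarith)]
      exact Real.sqrt_le_sqrt (by nlinarith)
    linarith
  have h2 : √x * √k ≤ √(x+k) * √(min x k) := by
    rw [← Real.sqrt_mul (by linarith), ← Real.sqrt_mul (by linarith)]
    apply Real.sqrt_le_sqrt
    rcases le_total x k with h | h
    · rw [min_eq_left h]; nlinarith
    · rw [min_eq_right h]; nlinarith
  calc √x * (√j + √k) ≤ √x * (2 * (√(1+j) * √k)) := by gcongr
    _ = 2 * √(1+j) * (√x * √k) := by ring
    _ ≤ 2 * √(1+j) * (√(x+k) * √(min x k)) := by gcongr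
    _ = _ := by ring

theorem sqrt_mul_sqrt_le_add (x k : ℝ) (hx : 1 ≤ x) (hk : 1 ≤ k) : √x * √k ≤ x + k := by
  have h1 : √x * √x = x := Real.mul_self_sqrt (by linarith)
  have h2 : √k * √k = k := Real.mul_self_sqrt (by linarith)
  nlinarith [sq_nonneg (√x - √k), Real.sqrt_nonneg x, Real.sqrt_nonneg k]

theorem r2 (x k j b : ℝ) (hx : 1 ≤ x) (hk : 1 ≤ k) (hj : 0 ≤ j) (hb0 : 0 ≤ b)
    (hb1 : b ≤ 2 * k) (hb2 : b ≤ 2 * (x + j)) :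
    √x * (√j + √k) * b ≤ 4 * (1+j) * (x+k) * min x k := by
  have h2 := sqrt_mul_sqrt_le_add x k hx hk
  have key : (√j + √k) * b ≤ √k * (4 * (1 + j) * min x k) := by
    have hj1 : √j ≤ 1 + j := by
      rw [Real.sqrt_le_left (by linarith)]; nlinarith
    have hk1 : 1 ≤ √k := by rw [Real.one_le_sqrt]; exact hk
    have hkk : √k * √k = k := Real.mul_self_sqrt (by linarith)
    have hjj : √j * √j = j := Real.mul_self_sqrt (by linarith)
    have hs : √j + √k ≤ √k * (2 * (1 + j)) := by nlinarith [Real.sqrt_nonneg j]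
    rcases le_total x k with h | h
    · rw [min_eq_left h]
      have hb3 : b ≤ 2 * x * (1 + j) := by nlinarith
      rcases le_total j k with h' | h'
      · have := Real.sqrt_le_sqrt h'
        calc (√j + √k) * b ≤ (√k + √k) * (2 * x * (1 + j)) := by gcongr
          _ = _ := by ring
      · have := Real.sqrt_le_sqrt h'
        have e1 : √j * b ≤ √k * (2 * (1 + j) * x) := by
          calc √j * b ≤ √j * (2 * k) := by gcongr
            _ = √k * (2 * (√j * √k)) := by linear_combination (-2 * √j) * hkk
            _ ≤ √k * (2 * (√j * √j)) := by gcongr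
            _ = √k * (2 * j * 1) := by rw [hjj, mul_one]
            _ ≤ √k * (2 * (1 + j) * x) := by gcongr; linarith
        have e2 : √k * b ≤ √k * (2 * x * (1 + j)) := by gcongr
        nlinarith
    · rw [min_eq_right h]
      calc (√j + √k) * b ≤ (√k * (2 * (1 + j))) * (2 * k) := by gcongr
        _ = _ := by ring
  have hm : 0 ≤ min x k := by apply le_min <;> linarith
  calc √x * (√j + √k) * b = √x * ((√j + √k) * b) := by ring
    _ ≤ √x * (√k * (4 * (1 + j) * min x k)) := by gcongr
    _ = (√x * √k) * (4 * (1 + j) * min x k) := by ring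
    _ ≤ (x + k) * (4 * (1 + j) * min x k) := by gcongr
    _ = _ := by ring

/-- The weight `√(1+i)`. -/
noncomputable def phi (i : ℕ) : ℝ := √(1 + (i:ℝ))

theorem phi_one_le (i : ℕ) : 1 ≤ phi i := by
  unfold phi; rw [Real.one_le_sqrt]; have : (0:ℝ) ≤ i := Nat.cast_nonneg i; linarith

theorem phi_sq (i : ℕ) : phi i * phi i = 1 + (i:ℝ) := Real.mul_self_sqrt (by positivity)

theorem phi_le (i : ℕ) : phi i ≤ 1 + (i:ℝ) := by
  rw [← phi_sq]; nlinarith [phi_one_le i]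

theorem phi_mono {i j : ℕ} (h : i ≤ j) : phi i ≤ phi j := by
  unfold phi; apply Real.sqrt_le_sqrt; have : (i:ℝ) ≤ j := Nat.cast_le.2 h; linarith

theorem phi_add (j k : ℕ) : phi (j+k) ≤ phi j + √(k:ℝ) := by
  unfold phi
  push_cast
  rw [Real.sqrt_le_left (by positivity), add_sq, Real.sq_sqrt (by positivity),
    Real.sq_sqrt (by positivity)]
  have : 0 ≤ 2 * √(1 + (j:ℝ)) * √(k:ℝ) := by positivity
  linarith

theorem phi_add' (j k : ℕ) : phi (j+k) ≤ phi j + phi k := by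
  refine (phi_add j k).trans ?_
  unfold phi
  gcongr
  linarith

/-- The extended kernel. -/
noncomputable def ax (a : ℕ → ℕ → ℕ → ℝ) (i j k : ℕ) : ℝ :=
  if 1 ≤ k ∧ k ≤ i then a i j k else 0

/-- The dominating weight. -/
noncomputable def Pw (q : ℕ → ℕ → ℝ) (i k : ℕ) : ℝ :=
  if 1 ≤ k ∧ k ≤ i then min ((i:ℝ) - k + 1) k * q i k else 0

theorem ax_nonneg {a : ℕ → ℕ → ℕ → ℝ} (ha : ∀ i j k, 0 ≤ a i j k) (i j k : ℕ) :
    0 ≤ ax a i j k := by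
  unfold ax; split_ifs; exacts [ha _ _ _, le_rfl]

/-- All that is needed about the kernel. -/
structure KB (a : ℕ → ℕ → ℕ → ℝ) (A B : ℝ) (P : ℕ → ℕ → ℝ) : Prop where
  hA : 0 ≤ A
  hB : 0 ≤ B
  hP : ∀ i k, 0 ≤ P i k
  hPs : ∀ i k, k ∉ Finset.Icc 1 i → P i k = 0
  hPB : ∀ i, ∑ k ∈ Finset.Icc 1 i, P i k ≤ B
  a0 : ∀ i j k, 0 ≤ ax a i j k
  e1 : ∀ i j k, ax a i j k * (phi (i-k) + phi (j+k) - phi i + phi j) ≤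
    A * (phi i * (1 + (j:ℝ)) * P i k)
  e2 : ∀ i j k, ax a i j k * (phi (i-k) + phi (j+k) + phi i - phi j) ≤
    A * ((1 + (i:ℝ)) * phi j * P i k)
  e3 : ∀ i j k, ax a i j k * (phi (i-k) + phi (j+k) + phi i + phi j) ≤
    A * ((1 + (i:ℝ)) * (1 + (j:ℝ)) * P i k)
  e4 : ∀ i j k : ℕ, ∀ b : ℝ, 0 ≤ b → b ≤ 2 * k → b ≤ 2 * ((i:ℝ) - k + 1 + j) →
    ax a i j k * b ≤ A * ((1 + (i:ℝ)) * (1 + (j:ℝ)) * P i k)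

theorem KB_of (a : ℕ → ℕ → ℕ → ℝ) (ha : ∀ i j k, 0 ≤ a i j k)
    (Q : ℝ) (q : ℕ → ℕ → ℝ) (hQ : 1 ≤ Q) (hq : ∀ i k, 0 ≤ q i k)
    (hqs : ∀ i : ℕ, 1 ≤ i →
      ∑ k ∈ Finset.Icc 1 i, (k : ℝ) * ((i : ℝ) - k + 1) * q i k ≤ Q * i)
    (α C' : ℝ) (hα0 : 0 ≤ α) (hα : α < 1 / 2) (hC' : 0 < C')
    (hbα : ∀ i j k : ℕ, 1 ≤ k → k ≤ i →
      a i j k ≤ C' * ((i : ℝ) - k + 1) ^ α * ((j : ℝ) ^ α + (k : ℝ) ^ α) * q i k) :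
    KB a (20 * C') (2 * Q) (Pw q) := by
  have h0 : ∀ i j k : ℕ, 1 ≤ k → k ≤ i →
      a i j k ≤ 2 * C' * (√((i:ℝ) - k + 1) * (√(j:ℝ) + √(k:ℝ))) * q i k := by
    intro i j k hk hki
    have hx : (1:ℝ) ≤ (i:ℝ) - k + 1 := by
      have : (k:ℝ) ≤ i := Nat.cast_le.2 hki
      linarith
    have hk' : (1:ℝ) ≤ k := by exact_mod_cast hk
    have e1 : ((i:ℝ) - k + 1) ^ α ≤ √((i:ℝ) - k + 1) := by
      rw [Real.sqrt_eq_rpow]; exact Real.rpow_le_rpow_of_exponent_le hx hα.le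
    have e2 : (k:ℝ) ^ α ≤ √(k:ℝ) := by
      rw [Real.sqrt_eq_rpow]; exact Real.rpow_le_rpow_of_exponent_le hk' hα.le
    have e3 : (1:ℝ) ≤ √(k:ℝ) := by rw [Real.one_le_sqrt]; exact hk'
    have e4 : (j:ℝ) ^ α ≤ √(j:ℝ) + √(k:ℝ) := by
      rcases Nat.eq_zero_or_pos j with h | h
      · subst h
        have := Real.rpow_le_one (x := ((0:ℕ):ℝ)) (by simp) (by simp) hα0
        simp only [Nat.cast_zero, Real.sqrt_zero] at this ⊢
        linarith
      · have hj' : (1:ℝ) ≤ j := by exact_mod_cast h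
        have : (j:ℝ) ^ α ≤ √(j:ℝ) := by
          rw [Real.sqrt_eq_rpow]; exact Real.rpow_le_rpow_of_exponent_le hj' hα.le
        linarith
    have e5 : (j:ℝ) ^ α + (k:ℝ) ^ α ≤ 2 * (√(j:ℝ) + √(k:ℝ)) := by
      linarith [Real.sqrt_nonneg (j:ℝ)]
    have hqq := hq i k
    have e6 : 0 ≤ ((i:ℝ) - k + 1) ^ α := Real.rpow_nonneg (by linarith) _
    have e7 : 0 ≤ (j:ℝ) ^ α + (k:ℝ) ^ α := by positivity
    calc a i j k ≤ C' * ((i : ℝ) - k + 1) ^ α * ((j : ℝ) ^ α + (k : ℝ) ^ α) * q i k :=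
          hbα i j k hk hki
      _ ≤ C' * √((i:ℝ) - k + 1) * (2 * (√(j:ℝ) + √(k:ℝ))) * q i k := by gcongr
      _ = _ := by ring
  have h1 : ∀ i j k : ℕ, 1 ≤ k → k ≤ i → a i j k ≤
      4 * C' * (phi j * phi i * √(min ((i:ℝ) - k + 1) k)) * q i k := by
    intro i j k hk hki
    have hx : (1:ℝ) ≤ (i:ℝ) - k + 1 := by
      have : (k:ℝ) ≤ i := Nat.cast_le.2 hki
      linarith
    have hk' : (1:ℝ) ≤ k := by exact_mod_cast hk
    have := r1 ((i:ℝ) - k + 1) k j hx hk' (Nat.cast_nonneg j)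
    rw [show (i:ℝ) - k + 1 + k = 1 + (i:ℝ) by ring] at this
    have hqq := hq i k
    calc _ ≤ _ := h0 i j k hk hki
      _ ≤ 2 * C' * (2 * √(1+(j:ℝ)) * √(1 + (i:ℝ)) * √(min ((i:ℝ) - k + 1) k)) * q i k := by
        gcongr
      _ = _ := by unfold phi; ring
  have aux : ∀ (i j k : ℕ) (b R : ℝ),
      (1 ≤ k → k ≤ i → a i j k * b ≤ 20 * C' * (R * (min ((i:ℝ) - k + 1) k * q i k))) →
      ax a i j k * b ≤ 20 * C' * (R * Pw q i k) := by
    intro i j k b R h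
    unfold ax Pw
    split_ifs with h'
    · exact h h'.1 h'.2
    · simp
  -- common facts
  have hb1 : ∀ i j k : ℕ, 1 ≤ k → k ≤ i →
      phi (i-k) + phi (j+k) - phi i + phi j ≤ 2 * phi j + √(min ((i:ℝ) - k + 1) k) := by
    intro i j k hk hki
    rcases le_total ((i:ℝ) - k + 1) k with h | h
    · rw [min_eq_left h]
      have e1 : phi (i-k) = √((i:ℝ) - k + 1) := by
        unfold phi; rw [Nat.cast_sub hki]; congr 1; ring
      have e2 : phi (j+k) ≤ phi j + phi i := (phi_mono (by omega)).trans (phi_add' j i)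
      linarith
    · rw [min_eq_right h]
      have e1 : phi (i-k) ≤ phi i := phi_mono (by omega)
      have e2 := phi_add j k
      linarith
  have hmu : ∀ i k : ℕ, 1 ≤ k → k ≤ i → 1 ≤ √(min ((i:ℝ) - k + 1) k) ∧
      √(min ((i:ℝ) - k + 1) k) * √(min ((i:ℝ) - k + 1) k) = min ((i:ℝ) - k + 1) k := by
    intro i k hk hki
    have hx : (1:ℝ) ≤ (i:ℝ) - k + 1 := by
      have : (k:ℝ) ≤ i := Nat.cast_le.2 hki
      linarith
    have hk' : (1:ℝ) ≤ k := by exact_mod_cast hk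
    have hm := le_min hx hk'
    exact ⟨by rw [Real.one_le_sqrt]; exact hm, Real.mul_self_sqrt (by linarith)⟩
  refine ⟨by positivity, by positivity, ?_, ?_, ?_, ax_nonneg ha, ?_, ?_, ?_, ?_⟩
  · intro i k
    unfold Pw; split_ifs with h
    · refine mul_nonneg (le_min ?_ (Nat.cast_nonneg _)) (hq _ _)
      have : (k:ℝ) ≤ i := Nat.cast_le.2 h.2
      linarith
    · exact le_rfl
  · intro i k h
    unfold Pw; rw [if_neg]; simpa using h
  · intro i
    rcases Nat.eq_zero_or_pos i with h | h
    · subst h; simp; linarith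
    have hi : (0:ℝ) < i := by exact_mod_cast h
    have : (i:ℝ) * ∑ k ∈ Finset.Icc 1 i, Pw q i k ≤
        2 * ∑ k ∈ Finset.Icc 1 i, (k : ℝ) * ((i : ℝ) - k + 1) * q i k := by
      rw [Finset.mul_sum, Finset.mul_sum]
      refine Finset.sum_le_sum fun k hk => ?_
      rw [Finset.mem_Icc] at hk
      unfold Pw; rw [if_pos hk]
      have h1 : (k:ℝ) ≤ i := Nat.cast_le.2 hk.2
      have h2 : (1:ℝ) ≤ k := by exact_mod_cast hk.1
      rw [← mul_assoc, ← mul_assoc]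
      refine mul_le_mul_of_nonneg_right ?_ (hq i k)
      rcases le_total ((i:ℝ) - k + 1) k with h | h
      · rw [min_eq_left h]; nlinarith
      · rw [min_eq_right h]; nlinarith
    have := this.trans (mul_le_mul_of_nonneg_left (hqs i h) (by norm_num))
    refine le_of_mul_le_mul_left ?_ hi
    linarith
  · intro i j k
    refine aux i j k _ _ fun hk hki => ?_
    have f1 := h1 i j k hk hki
    have f2 := hb1 i j k hk hki
    obtain ⟨f3, f4⟩ := hmu i k hk hki
    have f5 := phi_one_le j
    have f6 := phi_one_le i
    have hqq := hq i k
    set m := √(min ((i:ℝ) - k + 1) k)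
    rw [← f4, ← phi_sq]
    calc _ ≤ a i j k * (2 * phi j + m) := mul_le_mul_of_nonneg_left f2 (ha _ _ _)
      _ ≤ a i j k * (3 * (phi j * m)) := by
        refine mul_le_mul_of_nonneg_left ?_ (ha _ _ _)
        nlinarith
      _ ≤ (4 * C' * (phi j * phi i * m) * q i k) * (3 * (phi j * m)) := by gcongr
      _ = 12 * (C' * (phi i * (phi j * phi j) * (m * m * q i k))) := by ring
      _ ≤ 20 * (C' * (phi i * (phi j * phi j) * (m * m * q i k))) := by gcongr; norm_num
      _ = _ := by ring
  · intro i j k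
    refine aux i j k _ _ fun hk hki => ?_
    have f1 := h1 i j k hk hki
    have f2 : phi (i-k) + phi (j+k) + phi i - phi j ≤ 3 * phi i := by
      have e1 : phi (i-k) ≤ phi i := phi_mono (by omega)
      have e2 := phi_add' j k
      have e3 : phi k ≤ phi i := phi_mono hki
      linarith
    obtain ⟨f3, f4⟩ := hmu i k hk hki
    have f5 := phi_one_le j
    have f6 := phi_one_le i
    have hqq := hq i k
    set m := √(min ((i:ℝ) - k + 1) k)
    rw [← f4, ← phi_sq]
    calc _ ≤ a i j k * (3 * phi i) := mul_le_mul_of_nonneg_left f2 (ha _ _ _)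
      _ ≤ (4 * C' * (phi j * phi i * m) * q i k) * (3 * phi i) := by gcongr
      _ = 12 * (C' * (phi i * phi i * phi j * (m * 1 * q i k))) := by ring
      _ ≤ 20 * (C' * (phi i * phi i * phi j * (m * m * q i k))) := by gcongr; norm_num
      _ = _ := by ring
  · intro i j k
    refine aux i j k _ _ fun hk hki => ?_
    have f1 := h1 i j k hk hki
    obtain ⟨f3, f4⟩ := hmu i k hk hki
    have f5 := phi_one_le j
    have f6 := phi_one_le i
    have f2 : phi (i-k) + phi (j+k) + phi i + phi j ≤ 5 * (phi i * phi j) := by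
      have e1 : phi (i-k) ≤ phi i := phi_mono (by omega)
      have e2 := phi_add' j k
      have e3 : phi k ≤ phi i := phi_mono hki
      nlinarith
    have hqq := hq i k
    set m := √(min ((i:ℝ) - k + 1) k)
    rw [← f4, ← phi_sq, ← phi_sq]
    calc _ ≤ a i j k * (5 * (phi i * phi j)) := mul_le_mul_of_nonneg_left f2 (ha _ _ _)
      _ ≤ (4 * C' * (phi j * phi i * m) * q i k) * (5 * (phi i * phi j)) := by gcongr
      _ = 20 * (C' * (phi i * phi i * (phi j * phi j) * (m * 1 * q i k))) := by ring
      _ ≤ 20 * (C' * (phi i * phi i * (phi j * phi j) * (m * m * q i k))) := by gcongr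
      _ = _ := by ring
  · intro i j k b hb0 hb1 hb2
    refine aux i j k _ _ fun hk hki => ?_
    have hx : (1:ℝ) ≤ (i:ℝ) - k + 1 := by
      have : (k:ℝ) ≤ i := Nat.cast_le.2 hki
      linarith
    have hk' : (1:ℝ) ≤ k := by exact_mod_cast hk
    have f := r2 ((i:ℝ) - k + 1) k j b hx hk' (Nat.cast_nonneg j) hb0 hb1 hb2
    rw [show (i:ℝ) - k + 1 + k = 1 + (i:ℝ) by ring] at f
    have hqq := hq i k
    have hm : 0 ≤ min ((i:ℝ) - k + 1) k := le_min (by linarith) (by linarith)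
    calc _ ≤ (2 * C' * (√((i:ℝ) - k + 1) * (√(j:ℝ) + √(k:ℝ))) * q i k) * b := by
          gcongr; exact h0 i j k hk hki
      _ = 2 * C' * (√((i:ℝ) - k + 1) * (√(j:ℝ) + √(k:ℝ)) * b) * q i k := by ring
      _ ≤ 2 * C' * (4 * (1+(j:ℝ)) * (1 + (i:ℝ)) * min ((i:ℝ) - k + 1) k) * q i k := by gcongr
      _ = 8 * (C' * ((1 + (i:ℝ)) * (1 + (j:ℝ)) * (min ((i:ℝ) - k + 1) k * q i k))) := by ring
      _ ≤ 20 * (C' * ((1 + (i:ℝ)) * (1 + (j:ℝ)) * (min ((i:ℝ) - k + 1) k * q i k))) := by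
          gcongr; norm_num
      _ = _ := by ring

end

section

theorem TS (P : ℕ → ℕ → ℝ) (B : ℝ) (hP : ∀ i k, 0 ≤ P i k)
    (hPs : ∀ i k, k ∉ Finset.Icc 1 i → P i k = 0)
    (hPB : ∀ i, ∑ k ∈ Finset.Icc 1 i, P i k ≤ B)
    (u v : ℕ → ℝ) (hu : ∀ i, 0 ≤ u i) (hv : ∀ i, 0 ≤ v i) (hus : Summable u) (hvs : Summable v) :
    Summable (fun x : (ℕ × ℕ) × ℕ => u x.1.1 * v x.1.2 * P x.1.1 x.2) ∧
    ∑' x : (ℕ × ℕ) × ℕ, u x.1.1 * v x.1.2 * P x.1.1 x.2 ≤ B * ((∑' i, u i) * ∑' j, v j) := by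
  have huv : Summable (fun p : ℕ × ℕ => u p.1 * v p.2) := hus.mul_of_nonneg hvs hu hv
  have hPsum : ∀ i, Summable (P i) := fun i => summable_of_ne_finset_zero (fun k hk => hPs i k hk)
  have hPt : ∀ i, ∑' k, P i k ≤ B := fun i => by
    rw [tsum_eq_sum (fun k hk => hPs i k hk)]; exact hPB i
  have hle : ∀ p : ℕ × ℕ, ∑' k, u p.1 * v p.2 * P p.1 k ≤ B * (u p.1 * v p.2) := fun p => by
    rw [tsum_mul_left, mul_comm]
    exact mul_le_mul_of_nonneg_right (hPt _) (mul_nonneg (hu _) (hv _))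
  have hsk : Summable (fun p : ℕ × ℕ => ∑' k, u p.1 * v p.2 * P p.1 k) :=
    Summable.of_nonneg_of_le
      (fun p => tsum_nonneg fun k => mul_nonneg (mul_nonneg (hu _) (hv _)) (hP _ _)) hle
      (huv.mul_left B)
  have hs : Summable (fun x : (ℕ × ℕ) × ℕ => u x.1.1 * v x.1.2 * P x.1.1 x.2) := by
    have hnn : 0 ≤ (fun x : (ℕ × ℕ) × ℕ => u x.1.1 * v x.1.2 * P x.1.1 x.2) := by
      intro x
      exact mul_nonneg (mul_nonneg (hu _) (hv _)) (hP _ _)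
    rw [summable_prod_of_nonneg hnn]
    refine ⟨fun p => ?_, ?_⟩
    · exact (hPsum p.1).mul_left (u p.1 * v p.2)
    · exact hsk
  refine ⟨hs, ?_⟩
  rw [hs.tsum_prod, hus.tsum_mul_tsum hvs huv, ← tsum_mul_left]
  exact hsk.tsum_le_tsum hle (huv.mul_left B)

/-- Admissible states. -/
structure St (c : ℕ → ℝ) : Prop where
  nn : ∀ i, 0 ≤ c i
  sm : Summable (fun i : ℕ => (1 + (i : ℝ)) * c i)

/-- The total mass. -/
noncomputable def mass (c : ℕ → ℝ) : ℝ := ∑' i : ℕ, (1 + (i : ℝ)) * c i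

/-- The bracket. -/
def br (φ : ℕ → ℝ) (x : (ℕ × ℕ) × ℕ) : ℝ :=
  φ (x.1.1 - x.2) + φ (x.1.2 + x.2) - φ x.1.1 - φ x.1.2

/-- Terms of the weak form. -/
noncomputable def rt (a : ℕ → ℕ → ℕ → ℝ) (φ c : ℕ → ℝ) (x : (ℕ × ℕ) × ℕ) : ℝ :=
  ax a x.1.1 x.1.2 x.2 * br φ x * (c x.1.1 * c x.1.2)

/-- Dominating terms. -/
noncomputable def domt (P : ℕ → ℕ → ℝ) (c : ℕ → ℝ) (x : (ℕ × ℕ) × ℕ) : ℝ :=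
  ((1 + (x.1.1:ℝ)) * c x.1.1) * ((1 + (x.1.2:ℝ)) * c x.1.2) * P x.1.1 x.2

variable {a : ℕ → ℕ → ℕ → ℝ} {A B : ℝ} {P : ℕ → ℕ → ℝ}

theorem kb_dom (K : KB a A B P) {c : ℕ → ℝ} (hc : St c) :
    Summable (domt P c) ∧ ∑' x, domt P c x ≤ B * (mass c * mass c) := by
  have h1 : ∀ i : ℕ, 0 ≤ (1 + (i:ℝ)) * c i := fun i => mul_nonneg (by positivity) (hc.nn i)
  have := TS P B K.hP K.hPs K.hPB (fun i : ℕ => (1 + (i:ℝ)) * c i)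
    (fun i : ℕ => (1 + (i:ℝ)) * c i) h1 h1 hc.sm hc.sm
  unfold mass
  refine ⟨this.1.congr fun x => rfl, ?_⟩
  rw [show domt P c = fun x => domt P c x from rfl]
  simp only [domt]
  exact this.2

theorem abs_rt_le (K : KB a A B P) {c : ℕ → ℝ} (hc : St c) (φ : ℕ → ℝ) (x : (ℕ × ℕ) × ℕ)
    (h : ax a x.1.1 x.1.2 x.2 * |br φ x| ≤
      A * ((1 + (x.1.1:ℝ)) * (1 + (x.1.2:ℝ)) * P x.1.1 x.2)) :
    |rt a φ c x| ≤ A * domt P c x := by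
  have h0 : 0 ≤ c x.1.1 * c x.1.2 := mul_nonneg (hc.nn _) (hc.nn _)
  unfold rt domt
  rw [abs_mul, abs_mul, abs_of_nonneg h0, abs_of_nonneg (K.a0 _ _ _)]
  calc _ ≤ _ := mul_le_mul_of_nonneg_right h h0
    _ = _ := by ring

theorem abs_br_le (φ : ℕ → ℝ) (hφ : ∀ i, |φ i| ≤ phi i) (x : (ℕ × ℕ) × ℕ) :
    |br φ x| ≤ phi (x.1.1 - x.2) + phi (x.1.2 + x.2) + phi x.1.1 + phi x.1.2 := by
  unfold br
  have h1 := abs_le.1 (hφ (x.1.1 - x.2))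
  have h2 := abs_le.1 (hφ (x.1.2 + x.2))
  have h3 := abs_le.1 (hφ (x.1.1))
  have h4 := abs_le.1 (hφ (x.1.2))
  rw [abs_le]
  constructor <;> linarith

theorem abs_rt_phi (K : KB a A B P) {c : ℕ → ℝ} (hc : St c) (φ : ℕ → ℝ)
    (hφ : ∀ i, |φ i| ≤ phi i) (x : (ℕ × ℕ) × ℕ) :
    |rt a φ c x| ≤ A * domt P c x :=
  abs_rt_le K hc φ x <|
    (mul_le_mul_of_nonneg_left (abs_br_le φ hφ x) (K.a0 _ _ _)).trans (K.e3 _ _ _)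

/-- Weak form for finitely supported test sequences. -/
theorem weak_form (K : KB a A B P) {c : ℕ → ℝ} (hc : St c) (N : ℕ) (φ : ℕ → ℝ)
    (hN : ∀ n, N ≤ n → φ n = 0) :
    ∑ n ∈ Finset.range N, φ n * (Qi1 a c n + Qi2 a c n + Qi3 a c n + Qi4 a c n) =
      ∑' x, rt a φ c x := by
  set S : (ℕ × ℕ) × ℕ → ℝ := fun x => ax a x.1.1 x.1.2 x.2 * (c x.1.1 * c x.1.2) with hS
  have hSn : ∀ x, 0 ≤ S x := fun x => mul_nonneg (K.a0 _ _ _) (mul_nonneg (hc.nn _) (hc.nn _))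
  have hSs : Summable S := by
    refine Summable.of_nonneg_of_le hSn (fun x => ?_) ((kb_dom K hc).1.mul_left A)
    have h0 : 0 ≤ c x.1.1 * c x.1.2 := mul_nonneg (hc.nn _) (hc.nn _)
    have h1 := K.e3 x.1.1 x.1.2 x.2
    have h2 : ax a x.1.1 x.1.2 x.2 * 1 ≤ ax a x.1.1 x.1.2 x.2 *
        (phi (x.1.1 - x.2) + phi (x.1.2 + x.2) + phi x.1.1 + phi x.1.2) := by
      refine mul_le_mul_of_nonneg_left ?_ (K.a0 _ _ _)
      linarith [phi_one_le (x.1.1 - x.2), phi_one_le (x.1.2 + x.2), phi_one_le x.1.1,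
        phi_one_le x.1.2]
    have h3 := mul_le_mul_of_nonneg_right (h2.trans h1) h0
    unfold domt
    simp only [hS]
    calc _ = ax a x.1.1 x.1.2 x.2 * 1 * (c x.1.1 * c x.1.2) := by ring
      _ ≤ _ := h3
      _ = _ := by ring
  have hSi : ∀ (p : (ℕ × ℕ) × ℕ → Prop) [DecidablePred p],
      Summable (fun x => if p x then S x else 0) := by
    intro p _
    refine Summable.of_nonneg_of_le (fun x => ?_) (fun x => ?_) hSs
    · split_ifs; exacts [hSn x, le_rfl]
    · split_ifs; exacts [le_rfl, hSn x]
  have hS0 : ∀ x, S x ≠ 0 → 1 ≤ x.2 ∧ x.2 ≤ x.1.1 := by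
    intro x hx
    by_contra h
    apply hx
    simp only [hS]; unfold ax; rw [if_neg h, zero_mul]
  have q1 : ∀ n, Qi1 a c n = ∑' x : (ℕ × ℕ) × ℕ, if x.1.1 - x.2 = n then S x else 0 := by
    intro n
    have hinj : Function.Injective (fun p : ℕ × ℕ => (((n + p.1, p.2), p.1) : (ℕ × ℕ) × ℕ)) := by
      rintro ⟨p1, p2⟩ ⟨r1, r2⟩ h
      simp only [Prod.mk.injEq] at h ⊢
      omega
    rw [← hinj.tsum_eq]
    · unfold Qi1
      refine tsum_congr fun p => ?_
      simp only [hS]; unfold ax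
      by_cases h : 1 ≤ p.1
      · simp [h, mul_assoc]
      · simp [h]
    · rintro ⟨⟨i, j⟩, k⟩ hx
      simp only [Function.mem_support, ne_eq, ite_eq_right_iff, not_forall] at hx
      obtain ⟨h1, h2⟩ := hx
      have := hS0 _ h2
      simp only at this h1
      refine ⟨(k, j), ?_⟩
      simp only [Prod.mk.injEq, and_true]
      omega
  have q2 : ∀ n, Qi2 a c n = - ∑' x : (ℕ × ℕ) × ℕ, if x.1.2 = n then S x else 0 := by
    intro n
    have hinj : Function.Injective (fun p : ℕ × ℕ => (((p.2, n), p.1) : (ℕ × ℕ) × ℕ)) := by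
      rintro ⟨p1, p2⟩ ⟨r1, r2⟩ h
      simp only [Prod.mk.injEq] at h ⊢
      omega
    rw [← hinj.tsum_eq]
    · unfold Qi2
      congr 1
      refine tsum_congr fun p => ?_
      simp only [hS]; unfold ax
      by_cases h : 1 ≤ p.1 ∧ p.1 ≤ p.2
      · simp [h, mul_assoc]
      · simp only [if_neg h]; simp
    · rintro ⟨⟨i, j⟩, k⟩ hx
      simp only [Function.mem_support, ne_eq, ite_eq_right_iff, not_forall] at hx
      obtain ⟨h1, h2⟩ := hx
      exact ⟨(k, i), by simp [h1]⟩
  have q3 : ∀ n, Qi3 a c n = ∑' x : (ℕ × ℕ) × ℕ, if x.1.2 + x.2 = n then S x else 0 := by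
    intro n
    have hinj : Function.Injective (fun p : ℕ × ℕ => (((p.2, n - p.1), p.1) : (ℕ × ℕ) × ℕ)) := by
      rintro ⟨p1, p2⟩ ⟨r1, r2⟩ h
      simp only [Prod.mk.injEq] at h ⊢
      omega
    have hsm := (hSi (fun x => x.1.2 + x.2 = n)).comp_injective hinj
    rw [← hinj.tsum_eq]
    · have := hsm.tsum_prod
      simp only [Function.comp_def] at this
      rw [this, tsum_eq_sum (s := Finset.Icc 1 n)]
      · unfold Qi3
        refine Finset.sum_congr rfl fun k hk => tsum_congr fun j => ?_
        rw [Finset.mem_Icc] at hk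
        simp only [hS]; unfold ax
        rw [if_pos (show n - k + k = n by omega)]
        by_cases h : k ≤ j
        · simp [h, hk.1, mul_assoc]
        · simp [h]
      · intro k hk
        rw [Finset.mem_Icc] at hk
        refine (tsum_congr fun j => ?_).trans tsum_zero
        split_ifs with h
        · by_contra h'
          have := hS0 _ h'
          simp only at this
          omega
        · rfl
    · rintro ⟨⟨i, j⟩, k⟩ hx
      simp only [Function.mem_support, ne_eq, ite_eq_right_iff, not_forall] at hx
      obtain ⟨h1, h2⟩ := hx
      refine ⟨(k, i), ?_⟩
      simp only [Prod.mk.injEq, true_and, and_true]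
      omega
  have q4 : ∀ n, Qi4 a c n = - ∑' x : (ℕ × ℕ) × ℕ, if x.1.1 = n then S x else 0 := by
    intro n
    have hinj : Function.Injective (fun p : ℕ × ℕ => (((n, p.2), p.1) : (ℕ × ℕ) × ℕ)) := by
      rintro ⟨p1, p2⟩ ⟨r1, r2⟩ h
      simp only [Prod.mk.injEq] at h ⊢
      omega
    have hsm := (hSi (fun x => x.1.1 = n)).comp_injective hinj
    rw [← hinj.tsum_eq]
    · have := hsm.tsum_prod
      simp only [Function.comp_def, if_true] at this
      simp only [if_true]
      rw [this, tsum_eq_sum (s := Finset.Icc 1 n)]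
      · unfold Qi4
        congr 1
        refine Finset.sum_congr rfl fun k hk => tsum_congr fun j => ?_
        rw [Finset.mem_Icc] at hk
        simp only [hS]; unfold ax
        rw [if_pos hk]
        ring
      · intro k hk
        rw [Finset.mem_Icc] at hk
        refine (tsum_congr fun j => ?_).trans tsum_zero
        by_contra h'
        exact hk (hS0 _ h')
    · rintro ⟨⟨i, j⟩, k⟩ hx
      simp only [Function.mem_support, ne_eq, ite_eq_right_iff, not_forall] at hx
      obtain ⟨h1, h2⟩ := hx
      exact ⟨(k, j), by simp [h1]⟩
  have hG : ∀ n, HasSum (fun x : (ℕ × ℕ) × ℕ => φ n *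
      ((if x.1.1 - x.2 = n then S x else 0) + -(if x.1.2 = n then S x else 0) +
        (if x.1.2 + x.2 = n then S x else 0) + -(if x.1.1 = n then S x else 0)))
      (φ n * (Qi1 a c n + Qi2 a c n + Qi3 a c n + Qi4 a c n)) := by
    intro n
    rw [q1, q2, q3, q4]
    exact ((((hSi (fun x => x.1.1 - x.2 = n)).hasSum.add
      (hSi (fun x => x.1.2 = n)).hasSum.neg).add
      (hSi (fun x => x.1.2 + x.2 = n)).hasSum).add (hSi (fun x => x.1.1 = n)).hasSum.neg).mul_left _
  have hG2 := hasSum_sum (s := Finset.range N) (fun n _ => hG n)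
  rw [← hG2.tsum_eq]
  refine tsum_congr fun x => ?_
  have hf : ∀ m : ℕ, ∑ n ∈ Finset.range N, φ n * (if m = n then S x else 0) = φ m * S x := by
    intro m
    by_cases hm : m < N
    · rw [Finset.sum_eq_single m]
      · simp
      · intro b _ hb; rw [if_neg hb.symm, mul_zero]
      · intro h; exact absurd (Finset.mem_range.2 hm) h
    · rw [hN m (not_lt.1 hm), zero_mul]
      refine Finset.sum_eq_zero fun n hn => ?_
      rw [Finset.mem_range] at hn
      rw [if_neg (by omega), mul_zero]
  simp only [mul_add, mul_neg, Finset.sum_add_distrib, Finset.sum_neg_distrib, hf]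
  unfold rt br
  simp only [hS]
  ring

end

section

/-- Right-hand side of the system. -/
noncomputable def GG (a : ℕ → ℕ → ℕ → ℝ) (c : ℕ → ℝ → ℝ) (n : ℕ) (s : ℝ) : ℝ :=
  Qi1 a (fun m => c m s) n + Qi2 a (fun m => c m s) n +
    Qi3 a (fun m => c m s) n + Qi4 a (fun m => c m s) n

theorem sol_facts {a : ℕ → ℕ → ℕ → ℝ} {c0 : ℕ → ℝ} {T : ℝ} (hT : 0 < T) {c : ℕ → ℝ → ℝ}
    (hc : MildSolIso a c0 (Set.Icc 0 T) c) :
    (∀ s ∈ Set.Icc 0 T, St (fun n => c n s)) ∧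
    (∀ n, ∀ s ∈ Set.Icc 0 T, ∀ t ∈ Set.Icc 0 T, IntervalIntegrable (GG a c n) volume s t) ∧
    (∀ n, ∀ s ∈ Set.Icc 0 T, ∀ t ∈ Set.Icc 0 T, c n t - c n s = ∫ x in s..t, GG a c n x) := by
  obtain ⟨h1, h2, h3, h4⟩ := hc
  have hI : ∀ n, IntervalIntegrable (GG a c n) volume 0 T := by
    intro n
    obtain ⟨-, i1, i2, i3, i4, -⟩ := h4 n T ⟨hT.le, le_rfl⟩
    rw [intervalIntegrable_iff_integrableOn_Ioc_of_le hT.le]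
    exact ((i1.add i2).add i3).add i4
  have hII : ∀ n, ∀ s ∈ Set.Icc 0 T, ∀ t ∈ Set.Icc 0 T,
      IntervalIntegrable (GG a c n) volume s t := by
    intro n s hs t ht
    refine (hI n).mono_set ?_
    rw [Set.uIcc_of_le hT.le]
    exact Set.uIcc_subset_Icc hs ht
  refine ⟨fun s hs => ⟨(h2 s hs).1, (h2 s hs).2⟩, hII, ?_⟩
  intro n s hs t ht
  have e1 := (h4 n t ht).2.2.2.2.2
  have e2 := (h4 n s hs).2.2.2.2.2
  have h0 : (0:ℝ) ∈ Set.Icc 0 T := ⟨le_rfl, hT.le⟩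
  rw [e1, e2]
  have := intervalIntegral.integral_interval_sub_left (hII n 0 h0 t ht) (hII n 0 h0 s hs)
  unfold GG at this ⊢
  linarith

variable {a : ℕ → ℕ → ℕ → ℝ} {A B : ℝ} {P : ℕ → ℕ → ℝ}

theorem abs_tsum_rt (K : KB a A B P) {c : ℕ → ℝ} (hc : St c) (φ : ℕ → ℝ)
    (h : ∀ x, |rt a φ c x| ≤ A * domt P c x) {Bd : ℝ} (hB : mass c ≤ Bd) :
    |∑' x, rt a φ c x| ≤ A * (B * (Bd * Bd)) := by
  have hd := kb_dom K hc
  have h0 : 0 ≤ mass c := tsum_nonneg fun i => mul_nonneg (by positivity) (hc.nn i)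
  have h1 := tsum_of_norm_bounded (f := rt a φ c) (hd.1.mul_left A).hasSum h
  rw [Real.norm_eq_abs, tsum_mul_left] at h1
  refine h1.trans (mul_le_mul_of_nonneg_left (hd.2.trans ?_) K.hA)
  exact mul_le_mul_of_nonneg_left (mul_le_mul hB hB h0 (h0.trans hB)) K.hB

/-- Tent function. -/
noncomputable def tent (N n : ℕ) : ℝ := max 0 (min (1 + (n:ℝ)) ((N:ℝ) - n))

theorem tent_lip (N m n : ℕ) : |tent N m - tent N n| ≤ |(m:ℝ) - n| := by
  unfold tent
  refine (abs_max_sub_max_le_max _ _ _ _).trans (max_le (by simp) ?_)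
  refine (abs_min_sub_min_le_max _ _ _ _).trans (max_le ?_ ?_)
  · rw [show (1:ℝ) + m - (1 + n) = m - n by ring]
  · rw [show (N:ℝ) - m - (N - n) = -(m - n) by ring, abs_neg]

theorem tent_abs_le (N n : ℕ) : |tent N n| ≤ 1 + (n:ℝ) := by
  unfold tent
  rw [abs_of_nonneg (le_max_left _ _)]
  exact max_le (by positivity) (min_le_left _ _)

theorem tent_zero (N n : ℕ) (h : N ≤ n) : tent N n = 0 := by
  unfold tent
  have : (N:ℝ) ≤ n := by exact_mod_cast h
  exact max_eq_left ((min_le_right _ _).trans (by linarith))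

theorem tent_eq (N n : ℕ) (h : 2 * n + 1 ≤ N) : tent N n = 1 + (n:ℝ) := by
  unfold tent
  have : 2 * (n:ℝ) + 1 ≤ N := by exact_mod_cast h
  rw [min_eq_left (by linarith), max_eq_right (by positivity)]

theorem abs_rt_tent (K : KB a A B P) {c : ℕ → ℝ} (hc : St c) (N : ℕ) (x : (ℕ × ℕ) × ℕ) :
    |rt a (tent N) c x| ≤ A * domt P c x := by
  refine abs_rt_le K hc _ x ?_
  obtain ⟨⟨i, j⟩, k⟩ := x
  by_cases h : 1 ≤ k ∧ k ≤ i
  · refine K.e4 i j k _ (abs_nonneg _) ?_ ?_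
    · have h1 := tent_lip N (i - k) i
      have h2 := tent_lip N (j + k) j
      rw [Nat.cast_sub h.2, show (i:ℝ) - k - i = -k by ring, abs_neg, Nat.abs_cast] at h1
      rw [Nat.cast_add, show (j:ℝ) + k - j = k by ring, Nat.abs_cast] at h2
      rw [show br (tent N) ((i, j), k) = (tent N (i - k) - tent N i) + (tent N (j + k) - tent N j)
        by unfold br; ring]
      exact (abs_add_le _ _).trans (by linarith)
    · have h1 := tent_lip N (i - k) j
      have h2 := tent_lip N (j + k) i
      have hk : (k:ℝ) ≤ i := by exact_mod_cast h.2
      have hj : (0:ℝ) ≤ j := Nat.cast_nonneg j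
      have h3 : |(i:ℝ) - k - j| ≤ (i:ℝ) - k + 1 + j := by rw [abs_le]; constructor <;> linarith
      rw [Nat.cast_sub h.2] at h1
      rw [Nat.cast_add, show (j:ℝ) + k - i = -(i - k - j) by ring, abs_neg] at h2
      rw [show br (tent N) ((i, j), k) = (tent N (i - k) - tent N j) + (tent N (j + k) - tent N i)
        by unfold br; ring]
      exact (abs_add_le _ _).trans (by linarith)
  · have : ax a i j k = 0 := by unfold ax; rw [if_neg h]
    simp only [this, zero_mul]
    exact mul_nonneg K.hA (mul_nonneg (by positivity) (K.hP _ _))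

theorem rt_tent_tendsto (c : ℕ → ℝ) (x : (ℕ × ℕ) × ℕ) :
    Filter.Tendsto (fun N => rt a (tent N) c x) Filter.atTop (nhds 0) := by
  obtain ⟨⟨i, j⟩, k⟩ := x
  refine tendsto_const_nhds.congr' ?_
  filter_upwards [Filter.eventually_ge_atTop (2 * (i + j + k) + 1)] with N hN
  unfold rt
  by_cases h : 1 ≤ k ∧ k ≤ i
  · have : br (tent N) ((i, j), k) = 0 := by
      unfold br
      simp only
      rw [tent_eq N (i - k) (by omega), tent_eq N (j + k) (by omega), tent_eq N i (by omega),
        tent_eq N j (by omega), Nat.cast_sub h.2, Nat.cast_add]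
      ring
    rw [this]; ring
  · have : ax a i j k = 0 := by unfold ax; rw [if_neg h]
    simp only [this, zero_mul]

theorem tent_sum_tendsto {c : ℕ → ℝ} (hc : St c) :
    Filter.Tendsto (fun N => ∑ n ∈ Finset.range N, tent N n * c n) Filter.atTop
      (nhds (mass c)) := by
  have h1 : ∀ N, ∑ n ∈ Finset.range N, tent N n * c n = ∑' n, tent N n * c n := by
    intro N
    rw [tsum_eq_sum]
    intro n hn
    rw [Finset.mem_range, not_lt] at hn
    rw [tent_zero N n hn, zero_mul]
  simp only [h1]
  unfold mass
  refine tendsto_tsum_of_dominated_convergence hc.sm (fun n => ?_) (Filter.Eventually.of_forall ?_)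
  · refine tendsto_const_nhds.congr' ?_
    filter_upwards [Filter.eventually_ge_atTop (2 * n + 1)] with N hN
    rw [tent_eq N n hN]
  · intro N n
    rw [Real.norm_eq_abs, abs_mul, abs_of_nonneg (hc.nn n)]
    exact mul_le_mul_of_nonneg_right (tent_abs_le N n) (hc.nn n)

/-- Conservation on intervals where the mass is bounded. -/
theorem mass_cons (K : KB a A B P) {c0 : ℕ → ℝ} {T : ℝ} (hT : 0 < T) {c : ℕ → ℝ → ℝ}
    (hc : MildSolIso a c0 (Set.Icc 0 T) c) (s t Bd : ℝ) (hs : s ∈ Set.Icc 0 T)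
    (ht : t ∈ Set.Icc 0 T) (hst : s ≤ t)
    (hB : ∀ x ∈ Set.Icc s t, mass (fun n => c n x) ≤ Bd) :
    mass (fun n => c n s) = mass (fun n => c n t) := by
  obtain ⟨hS, hI, hE⟩ := sol_facts hT hc
  have hsub : ∀ x ∈ Set.uIoc s t, x ∈ Set.Icc s t := by
    intro x hx
    rw [Set.uIoc_of_le hst] at hx
    exact ⟨hx.1.le, hx.2⟩
  have hsub2 : ∀ x ∈ Set.Icc s t, x ∈ Set.Icc 0 T := fun x hx =>
    ⟨hs.1.trans hx.1, hx.2.trans ht.2⟩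
  have h1 : ∀ N, ∑ n ∈ Finset.range N, tent N n * c n t - ∑ n ∈ Finset.range N, tent N n * c n s =
      ∫ x in s..t, ∑ n ∈ Finset.range N, tent N n * GG a c n x := by
    intro N
    rw [intervalIntegral.integral_finsetSum (fun n _ => (hI n s hs t ht).const_mul _),
      ← Finset.sum_sub_distrib]
    refine Finset.sum_congr rfl fun n _ => ?_
    rw [intervalIntegral.integral_const_mul, ← hE n s hs t ht]
    ring
  have hw : ∀ N, ∀ x ∈ Set.Icc s t, ∑ n ∈ Finset.range N, tent N n * GG a c n x =
      ∑' y, rt a (tent N) (fun n => c n x) y := fun N x hx =>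
    weak_form K (hS x (hsub2 x hx)) N (tent N) (tent_zero N)
  have h2 : Filter.Tendsto (fun N => ∫ x in s..t, ∑ n ∈ Finset.range N, tent N n * GG a c n x)
      Filter.atTop (nhds (∫ x in s..t, (0:ℝ))) := by
    refine intervalIntegral.tendsto_integral_filter_of_dominated_convergence
      (fun _ => A * (B * (Bd * Bd))) (Filter.Eventually.of_forall fun N => ?_)
      (Filter.Eventually.of_forall fun N => Filter.Eventually.of_forall fun x hx => ?_)
      intervalIntegrable_const (Filter.Eventually.of_forall fun x hx => ?_)
    · have := IntervalIntegrable.sum (Finset.range N)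
        (f := fun n x => tent N n * GG a c n x) (fun n _ => (hI n s hs t ht).const_mul _)
      have h3 := (intervalIntegrable_iff.1 this).aestronglyMeasurable
      refine h3.congr (Filter.Eventually.of_forall fun x => ?_)
      simp
    · have hx' := hsub x hx
      rw [hw N x hx', Real.norm_eq_abs]
      exact abs_tsum_rt K (hS x (hsub2 x hx')) _ (abs_rt_tent K (hS x (hsub2 x hx')) N) (hB x hx')
    · have hx' := hsub x hx
      have hSt := hS x (hsub2 x hx')
      simp only [hw _ x hx']
      rw [← tsum_zero (α := ℝ) (β := (ℕ × ℕ) × ℕ)]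
      exact tendsto_tsum_of_dominated_convergence ((kb_dom K hSt).1.mul_left A)
        (fun y => rt_tent_tendsto _ y)
        (Filter.Eventually.of_forall fun N y => abs_rt_tent K hSt N y)
  have h3 := (tent_sum_tendsto (hS t ht)).sub (tent_sum_tendsto (hS s hs))
  simp only [h1] at h3
  have h4 := tendsto_nhds_unique h3 h2
  simp only [intervalIntegral.integral_zero] at h4
  linarith

theorem mass_const (K : KB a A B P) {c0 : ℕ → ℝ} {T : ℝ} (hT : 0 < T) {c : ℕ → ℝ → ℝ}
    (hc : MildSolIso a c0 (Set.Icc 0 T) c) (t : ℝ) (ht : t ∈ Set.Icc 0 T) :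
    mass (fun n => c n t) = mass c0 := by
  obtain ⟨hS, hI, hE⟩ := sol_facts hT hc
  set pr : ℝ → ℝ := fun x => max 0 (min x T) with hpr
  have hprm : ∀ x, pr x ∈ Set.Icc 0 T := fun x =>
    ⟨le_max_left _ _, max_le hT.le (min_le_right _ _)⟩
  have hprc : Continuous pr := by fun_prop
  have hpre : ∀ x ∈ Set.Icc 0 T, pr x = x := fun x hx => by
    simp only [hpr]; rw [min_eq_left hx.2, max_eq_right hx.1]
  have hprmono : Monotone pr := fun x y h => by
    simp only [hpr]; gcongr
  have key := baire_const (fun x => mass (fun n => c n (pr x))) (fun m => ?_) ?_ 0 t ht.1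
  · rw [hpre t ht, hpre 0 ⟨le_rfl, hT.le⟩] at key
    rw [← key]
    congr 1
    funext n
    exact hc.1 n
  · have : {x | mass (fun n => c n (pr x)) ≤ m} =
        ⋂ N : ℕ, {x | ∑ i ∈ Finset.range N, (1 + (i:ℝ)) * c i (pr x) ≤ m} := by
      ext x
      have hSt := hS _ (hprm x)
      have hnn : ∀ i : ℕ, 0 ≤ (1 + (i:ℝ)) * c i (pr x) := fun i =>
        mul_nonneg (by positivity) (hSt.nn i)
      simp only [Set.mem_ofPred_eq, Set.mem_iInter]
      constructor
      · intro h N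
        exact (hSt.sm.sum_le_tsum _ (fun i _ => hnn i)).trans h
      · intro h
        exact Real.tsum_le_of_sum_range_le hnn h
    rw [this]
    refine isClosed_iInter fun N => isClosed_le ?_ continuous_const
    refine continuous_finsetSum _ fun i _ => continuous_const.mul ?_
    exact (hc.2.2.1 i).comp_continuous hprc hprm
  · intro s u Bd hsu h
    refine mass_cons K hT hc (pr s) (pr u) Bd (hprm s) (hprm u) (hprmono hsu) ?_
    intro x hx
    have hxT : x ∈ Set.Icc 0 T := ⟨(hprm s).1.trans hx.1, hx.2.trans (hprm u).2⟩
    obtain ⟨y, hy, hyx⟩ := intermediate_value_Icc hsu hprc.continuousOn hx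
    have := h y hy
    simp only [hyx] at this
    exact this

end

section

theorem measurable_real_sign : Measurable Real.sign := by
  unfold Real.sign
  exact Measurable.ite measurableSet_Iio measurable_const
    (Measurable.ite measurableSet_Ioi measurable_const measurable_const)

theorem abs_real_sign_le (r : ℝ) : |Real.sign r| ≤ 1 := by
  rcases Real.sign_apply_eq r with h | h | h <;> rw [h] <;> norm_num

theorem real_sign_mul_self (r : ℝ) : Real.sign r * r = |r| := by
  rcases lt_trichotomy r 0 with h | h | h
  · rw [Real.sign_of_neg h, abs_of_neg h]; ring
  · simp [h]
  · rw [Real.sign_of_pos h, abs_of_pos h]; ring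

variable {a : ℕ → ℕ → ℕ → ℝ} {A B : ℝ} {P : ℕ → ℕ → ℝ}

theorem abs_psi (w : ℝ) (i : ℕ) : |phi i * Real.sign w| ≤ phi i := by
  have h := phi_one_le i
  rw [abs_mul, abs_of_nonneg (by linarith)]
  exact mul_le_of_le_one_right (by linarith) (abs_real_sign_le w)

theorem summable_phi_diff {c d : ℕ → ℝ} (hc : St c) (hd : St d) :
    Summable (fun i => phi i * |c i - d i|) ∧
      ∑' i, phi i * |c i - d i| ≤ mass c + mass d := by
  have hle : ∀ i, phi i * |c i - d i| ≤ (1 + (i:ℝ)) * c i + (1 + (i:ℝ)) * d i := by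
    intro i
    rw [← mul_add]
    refine mul_le_mul (phi_le i) ?_ (abs_nonneg _) (by positivity)
    have := hc.nn i
    have := hd.nn i
    rw [abs_le]; constructor <;> linarith
  have hs : Summable (fun i => phi i * |c i - d i|) :=
    Summable.of_nonneg_of_le
      (fun i => mul_nonneg (by linarith [phi_one_le i]) (abs_nonneg _)) hle (hc.sm.add hd.sm)
  refine ⟨hs, ?_⟩
  unfold mass
  rw [← hc.sm.tsum_add hd.sm]
  exact hs.tsum_le_tsum hle (hc.sm.add hd.sm)

/-- Key Lipschitz-type estimate. -/
theorem key_est (K : KB a A B P) {c d : ℕ → ℝ} (hc : St c) (hd : St d) {Kc : ℝ}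
    (hcK : mass c = Kc) (hdK : mass d = Kc) :
    ∑' x, rt a (fun i => phi i * Real.sign (c i - d i)) c x -
      ∑' x, rt a (fun i => phi i * Real.sign (c i - d i)) d x ≤
      2 * (A * (B * Kc)) * ∑' i, phi i * |c i - d i| := by
  set ψ : ℕ → ℝ := fun i => phi i * Real.sign (c i - d i) with hψ
  have hψb : ∀ i, |ψ i| ≤ phi i := fun i => abs_psi _ i
  have hsc : Summable (rt a ψ c) :=
    Summable.of_norm_bounded ((kb_dom K hc).1.mul_left A) (abs_rt_phi K hc ψ hψb)
  have hsd : Summable (rt a ψ d) :=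
    Summable.of_norm_bounded ((kb_dom K hd).1.mul_left A) (abs_rt_phi K hd ψ hψb)
  have hw := (summable_phi_diff hc hd).1
  have hw0 : ∀ i, 0 ≤ phi i * |c i - d i| := fun i =>
    mul_nonneg (by linarith [phi_one_le i]) (abs_nonneg _)
  have hc0 : ∀ i : ℕ, 0 ≤ (1 + (i:ℝ)) * c i := fun i => mul_nonneg (by positivity) (hc.nn i)
  have hd0 : ∀ i : ℕ, 0 ≤ (1 + (i:ℝ)) * d i := fun i => mul_nonneg (by positivity) (hd.nn i)
  have t1 := TS P B K.hP K.hPs K.hPB (fun i => phi i * |c i - d i|)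
    (fun i : ℕ => (1 + (i:ℝ)) * c i) hw0 hc0 hw hc.sm
  have t2 := TS P B K.hP K.hPs K.hPB (fun i : ℕ => (1 + (i:ℝ)) * d i)
    (fun i => phi i * |c i - d i|) hd0 hw0 hd.sm hw
  rw [← hsc.tsum_sub hsd]
  have hle : ∀ x : (ℕ × ℕ) × ℕ, rt a ψ c x - rt a ψ d x ≤
      A * ((phi x.1.1 * |c x.1.1 - d x.1.1|) * ((1 + (x.1.2:ℝ)) * c x.1.2) * P x.1.1 x.2) +
      A * (((1 + (x.1.1:ℝ)) * d x.1.1) * (phi x.1.2 * |c x.1.2 - d x.1.2|) * P x.1.1 x.2) := by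
    rintro ⟨⟨i, j⟩, k⟩
    simp only
    have p1 := abs_le.1 (hψb (i - k))
    have p2 := abs_le.1 (hψb (j + k))
    have p3 := abs_le.1 (hψb i)
    have p4 := abs_le.1 (hψb j)
    have s1 : ψ i * (c i - d i) = phi i * |c i - d i| := by
      simp only [hψ]; rw [mul_assoc, real_sign_mul_self]
    have s2 : ψ j * (c j - d j) = phi j * |c j - d j| := by
      simp only [hψ]; rw [mul_assoc, real_sign_mul_self]
    have aux : ∀ y w : ℝ, ∀ b : ℝ, |y| ≤ b → y * w ≤ b * |w| := by
      intro y w b h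
      calc y * w ≤ |y * w| := le_abs_self _
        _ = |y| * |w| := abs_mul _ _
        _ ≤ b * |w| := mul_le_mul_of_nonneg_right h (abs_nonneg _)
    have b1 : br ψ ((i, j), k) * (c i - d i) ≤
        (phi (i-k) + phi (j+k) - phi i + phi j) * |c i - d i| := by
      have := aux (ψ (i-k) + ψ (j+k) - ψ j) (c i - d i) (phi (i-k) + phi (j+k) + phi j)
        (by rw [abs_le]; constructor <;> linarith)
      unfold br; simp only
      linarith
    have b2 : br ψ ((i, j), k) * (c j - d j) ≤
        (phi (i-k) + phi (j+k) + phi i - phi j) * |c j - d j| := by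
      have := aux (ψ (i-k) + ψ (j+k) - ψ i) (c j - d j) (phi (i-k) + phi (j+k) + phi i)
        (by rw [abs_le]; constructor <;> linarith)
      unfold br; simp only
      linarith
    have g1 : ax a i j k * (br ψ ((i, j), k) * (c i - d i)) * c j ≤
        A * ((phi i * |c i - d i|) * ((1 + (j:ℝ)) * c j) * P i k) := by
      have h1 := mul_le_mul_of_nonneg_right
        (mul_le_mul_of_nonneg_left b1 (K.a0 i j k)) (hc.nn j)
      have h2 := mul_le_mul_of_nonneg_right (K.e1 i j k)
        (mul_nonneg (abs_nonneg (c i - d i)) (hc.nn j))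
      linarith
    have g2 : ax a i j k * (br ψ ((i, j), k) * (c j - d j)) * d i ≤
        A * (((1 + (i:ℝ)) * d i) * (phi j * |c j - d j|) * P i k) := by
      have h1 := mul_le_mul_of_nonneg_right
        (mul_le_mul_of_nonneg_left b2 (K.a0 i j k)) (hd.nn i)
      have h2 := mul_le_mul_of_nonneg_right (K.e2 i j k)
        (mul_nonneg (abs_nonneg (c j - d j)) (hd.nn i))
      linarith
    unfold rt
    simp only
    linarith
  have hf := (hsc.sub hsd).tsum_le_tsum hle ((t1.1.mul_left A).add (t2.1.mul_left A))
  rw [(t1.1.mul_left A).tsum_add (t2.1.mul_left A), tsum_mul_left, tsum_mul_left] at hf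
  have u1 := mul_le_mul_of_nonneg_left t1.2 K.hA
  have u2 := mul_le_mul_of_nonneg_left t2.2 K.hA
  rw [show (∑' i : ℕ, (1 + (i:ℝ)) * c i) = Kc from hcK] at u1
  rw [show (∑' i : ℕ, (1 + (i:ℝ)) * d i) = Kc from hdK] at u2
  linarith

theorem integral_step (K : KB a A B P) {c0 : ℕ → ℝ} {T : ℝ} (hT : 0 < T) {c d : ℕ → ℝ → ℝ}
    (hc : MildSolIso a c0 (Set.Icc 0 T) c) (hd : MildSolIso a c0 (Set.Icc 0 T) d)
    (t : ℝ) (ht : t ∈ Set.Icc 0 T) :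
    ∑' i, phi i * |c i t - d i t| = ∫ s in (0:ℝ)..t,
      (∑' x, rt a (fun i => phi i * Real.sign (c i s - d i s)) (fun n => c n s) x -
      ∑' x, rt a (fun i => phi i * Real.sign (c i s - d i s)) (fun n => d n s) x) := by
  obtain ⟨hSc, hIc, hEc⟩ := sol_facts hT hc
  obtain ⟨hSd, hId, hEd⟩ := sol_facts hT hd
  have h0 : (0:ℝ) ∈ Set.Icc 0 T := ⟨le_rfl, hT.le⟩
  have hsub : ∀ x ∈ Set.uIoc 0 t, x ∈ Set.Icc 0 T := by
    intro x hx
    rw [Set.uIoc_of_le ht.1] at hx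
    exact ⟨hx.1.le, hx.2.trans ht.2⟩
  have hsub' : ∀ x ∈ Set.uIcc 0 t, x ∈ Set.Icc 0 T := by
    intro x hx
    rw [Set.uIcc_of_le ht.1] at hx
    exact ⟨hx.1, hx.2.trans ht.2⟩
  have hw : ∀ n, ∀ s ∈ Set.Icc 0 T, c n s - d n s = ∫ x in (0:ℝ)..s, (GG a c n x - GG a d n x) := by
    intro n s hs
    rw [intervalIntegral.integral_sub (hIc n 0 h0 s hs) (hId n 0 h0 s hs), ← hEc n 0 h0 s hs,
      ← hEd n 0 h0 s hs, hc.1 n, hd.1 n]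
    ring
  have hg : ∀ n, IntervalIntegrable (fun x => GG a c n x - GG a d n x) volume 0 t := fun n =>
    (hIc n 0 h0 t ht).sub (hId n 0 h0 t ht)
  have habs : ∀ n, |c n t - d n t| =
      ∫ s in (0:ℝ)..t, Real.sign (c n s - d n s) * (GG a c n s - GG a d n s) := by
    intro n
    rw [hw n t ht, abs_primitive _ t (hg n)]
    refine intervalIntegral.integral_congr fun s hs => ?_
    rw [hw n s (hsub' s hs)]
  have hsg : ∀ n, IntervalIntegrable
      (fun s => Real.sign (c n s - d n s) * (GG a c n s - GG a d n s)) volume 0 t := by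
    intro n
    have h1 := intervalIntegrable_iff.1 (hg n)
    rw [intervalIntegrable_iff]
    refine Integrable.bdd_mul (c := 1) h1 ?_ (Filter.Eventually.of_forall fun s => ?_)
    · have hcont : ContinuousOn (fun s => c n s - d n s) (Set.uIoc 0 t) :=
        ((hc.2.2.1 n).sub (hd.2.2.1 n)).mono hsub
      have := (hcont.aestronglyMeasurable (μ := volume) measurableSet_uIoc).aemeasurable
      exact (measurable_real_sign.comp_aemeasurable this).aestronglyMeasurable
    · rw [Real.norm_eq_abs]; exact abs_real_sign_le _
  -- truncated identity
  have h1 : ∀ N, ∑ n ∈ Finset.range N, phi n * |c n t - d n t| =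
      ∫ s in (0:ℝ)..t, ∑ n ∈ Finset.range N,
        phi n * (Real.sign (c n s - d n s) * (GG a c n s - GG a d n s)) := by
    intro N
    rw [intervalIntegral.integral_finsetSum (fun n _ => (hsg n).const_mul _)]
    refine Finset.sum_congr rfl fun n _ => ?_
    rw [intervalIntegral.integral_const_mul, habs n]
  set ψ : ℕ → ℝ → ℕ → ℝ := fun N s i => if i < N then phi i * Real.sign (c i s - d i s) else 0
    with hψ
  have hψb : ∀ N s i, |ψ N s i| ≤ phi i := by
    intro N s i
    simp only [hψ]
    split_ifs
    · exact abs_psi _ i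
    · rw [abs_zero]; linarith [phi_one_le i]
  have hψ0 : ∀ N s i, N ≤ i → ψ N s i = 0 := fun N s i h => by
    simp only [hψ]; rw [if_neg (not_lt.2 h)]
  have h2 : ∀ N, ∀ s ∈ Set.Icc 0 T, ∑ n ∈ Finset.range N,
        phi n * (Real.sign (c n s - d n s) * (GG a c n s - GG a d n s)) =
      ∑' x, rt a (ψ N s) (fun n => c n s) x - ∑' x, rt a (ψ N s) (fun n => d n s) x := by
    intro N s hs
    rw [← weak_form K (hSc s hs) N (ψ N s) (hψ0 N s), ← weak_form K (hSd s hs) N (ψ N s) (hψ0 N s),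
      ← Finset.sum_sub_distrib]
    refine Finset.sum_congr rfl fun n hn => ?_
    simp only [hψ]
    rw [if_pos (Finset.mem_range.1 hn)]
    unfold GG
    ring
  have hlim : ∀ (s : ℝ) (e : ℕ → ℝ), St e → Filter.Tendsto (fun N => ∑' x, rt a (ψ N s) e x)
      Filter.atTop (nhds (∑' x, rt a (fun i => phi i * Real.sign (c i s - d i s)) e x)) := by
    intro s e he
    refine tendsto_tsum_of_dominated_convergence ((kb_dom K he).1.mul_left A) (fun x => ?_)
      (Filter.Eventually.of_forall fun N x => abs_rt_phi K he _ (hψb N s) x)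
    obtain ⟨⟨i, j⟩, k⟩ := x
    refine tendsto_const_nhds.congr' ?_
    filter_upwards [Filter.eventually_ge_atTop (i + j + k + 1)] with N hN
    unfold rt br
    simp only [hψ]
    rw [if_pos (by omega), if_pos (by omega), if_pos (by omega), if_pos (by omega)]
  have h3 : Filter.Tendsto (fun N => ∫ s in (0:ℝ)..t, ∑ n ∈ Finset.range N,
        phi n * (Real.sign (c n s - d n s) * (GG a c n s - GG a d n s)))
      Filter.atTop (nhds (∫ s in (0:ℝ)..t,
      (∑' x, rt a (fun i => phi i * Real.sign (c i s - d i s)) (fun n => c n s) x -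
      ∑' x, rt a (fun i => phi i * Real.sign (c i s - d i s)) (fun n => d n s) x))) := by
    refine intervalIntegral.tendsto_integral_filter_of_dominated_convergence
      (fun _ => A * (B * (mass c0 * mass c0)) + A * (B * (mass c0 * mass c0)))
      (Filter.Eventually.of_forall fun N => ?_)
      (Filter.Eventually.of_forall fun N => Filter.Eventually.of_forall fun s hs => ?_)
      intervalIntegrable_const (Filter.Eventually.of_forall fun s hs => ?_)
    · have := IntervalIntegrable.sum (Finset.range N)
        (f := fun n s => phi n * (Real.sign (c n s - d n s) * (GG a c n s - GG a d n s)))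
        (fun n _ => (hsg n).const_mul _)
      have h3 := (intervalIntegrable_iff.1 this).aestronglyMeasurable
      refine h3.congr (Filter.Eventually.of_forall fun x => ?_)
      simp
    · have hs' := hsub s hs
      rw [h2 N s hs', Real.norm_eq_abs]
      refine (abs_sub _ _).trans (add_le_add ?_ ?_)
      · exact abs_tsum_rt K (hSc s hs') _ (abs_rt_phi K (hSc s hs') _ (hψb N s))
          (mass_const K hT hc s hs').le
      · exact abs_tsum_rt K (hSd s hs') _ (abs_rt_phi K (hSd s hs') _ (hψb N s))
          (mass_const K hT hd s hs').le
    · have hs' := hsub s hs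
      simp only [h2 _ s hs']
      exact (hlim s _ (hSc s hs')).sub (hlim s _ (hSd s hs'))
  have h4 := (summable_phi_diff (hSc t ht) (hSd t ht)).1.hasSum.tendsto_sum_nat
  simp only [h1] at h4
  exact tendsto_nhds_unique h4 h3

theorem uniq_core (K : KB a A B P) {c0 : ℕ → ℝ} {T : ℝ} (hT : 0 < T) {c d : ℕ → ℝ → ℝ}
    (hc : MildSolIso a c0 (Set.Icc 0 T) c) (hd : MildSolIso a c0 (Set.Icc 0 T) d) :
    ∀ i : ℕ, ∀ t ∈ Set.Icc (0 : ℝ) T, c i t = d i t := by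
  obtain ⟨hSc, hIc, hEc⟩ := sol_facts hT hc
  obtain ⟨hSd, hId, hEd⟩ := sol_facts hT hd
  have h0 : (0:ℝ) ∈ Set.Icc 0 T := ⟨le_rfl, hT.le⟩
  have hm0 : 0 ≤ mass c0 := by
    rw [← mass_const K hT hc 0 h0]
    exact tsum_nonneg fun i => mul_nonneg (by positivity) ((hSc 0 h0).nn i)
  set L : ℝ := 2 * (A * (B * mass c0)) with hL
  have hL0 : 0 ≤ L := by
    have := mul_nonneg K.hA (mul_nonneg K.hB hm0)
    linarith
  set U : ℝ := mass c0 + mass c0 with hU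
  have hU0 : 0 ≤ U := by linarith
  have hind : ∀ n : ℕ, ∀ t ∈ Set.Icc (0:ℝ) T,
      ∑' i, phi i * |c i t - d i t| ≤ U * ((L * t) ^ n / (n.factorial : ℝ)) := by
    intro n
    induction n with
    | zero =>
      intro t ht
      have := (summable_phi_diff (hSc t ht) (hSd t ht)).2
      rw [mass_const K hT hc t ht, mass_const K hT hd t ht] at this
      simpa using this
    | succ n ih =>
      intro t ht
      rw [integral_step K hT hc hd t ht]
      have hcalc : ∫ s in (0:ℝ)..t, L * (U * ((L * s) ^ n / (n.factorial : ℝ))) =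
          U * ((L * t) ^ (n+1) / ((n+1).factorial : ℝ)) := by
        have : ∀ s : ℝ, L * (U * ((L * s) ^ n / (n.factorial : ℝ))) =
            (L * U * L ^ n / (n.factorial : ℝ)) * s ^ n := fun s => by
          rw [mul_pow]; ring
        simp only [this]
        rw [intervalIntegral.integral_const_mul, integral_pow, Nat.factorial_succ]
        push_cast
        have : (n.factorial : ℝ) ≠ 0 := by positivity
        have : (n:ℝ) + 1 ≠ 0 := by positivity
        field_simp
        ring
      by_cases hInt0 : IntervalIntegrable (fun s =>
          (∑' x, rt a (fun i => phi i * Real.sign (c i s - d i s)) (fun n => c n s) x -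
          ∑' x, rt a (fun i => phi i * Real.sign (c i s - d i s)) (fun n => d n s) x)) volume 0 t
      · rw [← hcalc]
        refine intervalIntegral.integral_mono_on ht.1 hInt0 ?_ ?_
        · exact Continuous.intervalIntegrable (by fun_prop) _ _
        · intro s hs
          have hs' : s ∈ Set.Icc 0 T := ⟨hs.1, hs.2.trans ht.2⟩
          refine (key_est K (hSc s hs') (hSd s hs') (mass_const K hT hc s hs')
            (mass_const K hT hd s hs')).trans ?_
          exact mul_le_mul_of_nonneg_left (ih s hs') hL0
      · rw [intervalIntegral.integral_undef hInt0]
        have := mul_nonneg hL0 ht.1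
        positivity
  intro i t ht
  have hz : ∑' i, phi i * |c i t - d i t| ≤ 0 := by
    have hl := (FloorSemiring.tendsto_pow_div_factorial_atTop (L * t)).const_mul U
    rw [mul_zero] at hl
    exact ge_of_tendsto' hl fun n => hind n t ht
  have hs := (summable_phi_diff (hSc t ht) (hSd t ht)).1
  have hw0 : ∀ i, 0 ≤ phi i * |c i t - d i t| := fun i =>
    mul_nonneg (by linarith [phi_one_le i]) (abs_nonneg _)
  have h1 : phi i * |c i t - d i t| ≤ 0 := (hs.le_tsum i fun j _ => hw0 j).trans hz
  have h2 := phi_one_le i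
  have h3 : |c i t - d i t| ≤ 0 := by
    nlinarith [abs_nonneg (c i t - d i t)]
  have := abs_nonpos_iff.1 h3
  linarith

end

/-- Theorem 7.2: uniqueness of mild solutions of the isolated DGED system under the
additional growth condition with exponent `α ∈ [0, 1/2)`. -/
theorem mild_solution_uniqueness_isolated
    (a : ℕ → ℕ → ℕ → ℝ) (ha : ∀ i j k, 0 ≤ a i j k)
    (hzero : ∀ p : ℕ, 1 ≤ p → a p 0 p = 0)
    (C Q : ℝ) (q : ℕ → ℕ → ℝ) (hGB : GB a C Q q)
    (α C' : ℝ) (hα0 : 0 ≤ α) (hα : α < 1 / 2) (hC' : 0 < C')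
    (hbα : ∀ i j k : ℕ, 1 ≤ k → k ≤ i →
      a i j k ≤ C' * ((i : ℝ) - k + 1) ^ α * ((j : ℝ) ^ α + (k : ℝ) ^ α) * q i k)
    (T : ℝ) (hT : 0 < T)
    (c0 : ℕ → ℝ) (hc0 : ∀ i, 0 ≤ c0 i)
    (hX : Summable (fun i : ℕ => (1 + (i : ℝ)) * c0 i))
    (c d : ℕ → ℝ → ℝ)
    (hc : MildSolIso a c0 (Set.Icc 0 T) c) (hd : MildSolIso a c0 (Set.Icc 0 T) d) :
    ∀ i : ℕ, ∀ t ∈ Set.Icc (0 : ℝ) T, c i t = d i t := by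
  obtain ⟨_, hQ, hq, hqs, _⟩ := hGB
  exact uniq_core (KB_of a ha Q q hQ hq hqs α C' hα0 hα hC' hbα) hT hc hd
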